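/- For the cubic f = (1/2)(x_0 x_4² + x_1 x_5² + x_2 x_6² + x_3 L²) in K[x_0,...,x_6] with L = x_4 + x_5 + x_6, the differential of the map sending a cubic to its Hessian determinant, evaluated at f, has rank at least 38; consequently the tangent space to the scheme {hess = 0} ⊂ P(S_3) = P^{83} at f has dimension at most 45. -/

import Mathlib

open MvPolynomial

/-- The adjugate of the Hessian of `½(x₀a² + x₁b² + x₂c² + x₃s²)`, a symmetric matrix of corank
one, is minus the square of its kernel vector. -/
theorem hessian_adjugate {R : Type*} [CommRing R] [IsDomain R] (a b c s x y z t : R)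
    (ha : a ≠ 0) (hb : b ≠ 0) (hc : c ≠ 0) (i j : Fin 7) :
    Matrix.adjugate !![0, 0, 0, 0, a, 0, 0;
        0, 0, 0, 0, 0, b, 0;
        0, 0, 0, 0, 0, 0, c;
        0, 0, 0, 0, s, s, s;
        a, 0, 0, s, x + t, t, t;
        0, b, 0, s, t, y + t, t;
        0, 0, c, s, t, t, z + t] i j =
      -(![b * c * s, a * c * s, a * b * s, -(a * b * c), 0, 0, 0] i *
        ![b * c * s, a * c * s, a * b * s, -(a * b * c), 0, 0, 0] j) := by
  set w : Fin 7 → R := ![b * c * s, a * c * s, a * b * s, -(a * b * c), 0, 0, 0] with hw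
  set H : Matrix (Fin 7) (Fin 7) R := !![0, 0, 0, 0, a, 0, 0;
        0, 0, 0, 0, 0, b, 0;
        0, 0, 0, 0, 0, 0, c;
        0, 0, 0, 0, s, s, s;
        a, 0, 0, s, x + t, t, t;
        0, b, 0, s, t, y + t, t;
        0, 0, c, s, t, t, z + t] with hH
  have hw3 : w 3 ≠ 0 := by simp [hw, ha, hb, hc]
  have hdet : H.det = 0 := by
    rw [← Matrix.exists_mulVec_eq_zero_iff]
    refine ⟨w, fun h => hw3 (congrFun h 3), ?_⟩
    ext i
    fin_cases i <;> simp [hH, hw, Matrix.mulVec, dotProduct, Fin.sum_univ_succ] <;> ring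
  have hsymm : H.IsSymm := by
    ext i j
    fin_cases i <;> fin_cases j <;> rfl
  have hadj (i j : Fin 7) : H.adjugate i j = H.adjugate j i := hsymm.adjugate.apply j i
  have h33 : H.adjugate 3 3 = -(w 3 * w 3) := by
    simp [hH, hw, Matrix.adjugate_apply, Matrix.updateRow_apply, Matrix.det_succ_row_zero,
      Fin.sum_univ_succ, Fin.succAbove]
    ring
  have hmul (i j : Fin 7) : ∑ k, H i k * H.adjugate k j = 0 := by
    simpa [hdet, Matrix.mul_apply] using congrFun₂ (Matrix.mul_adjugate H) i j
  have key (i j : Fin 7) : H.adjugate i j * w 3 = w i * H.adjugate 3 j := by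
    have h0 := hmul 0 j
    have h1 := hmul 1 j
    have h2 := hmul 2 j
    have h4 := hmul 4 j
    have h5 := hmul 5 j
    have h6 := hmul 6 j
    generalize H.adjugate = M at *
    simp [hH, Fin.sum_univ_succ, ha, hb, hc] at h0 h1 h2 h4 h5 h6
    simp [h0, h1, h2] at h4 h5 h6
    fin_cases i <;> simp [hw]
    · linear_combination (-b * c) * h4
    · linear_combination (-a * c) * h5
    · linear_combination (-a * b) * h6
    · ring
    all_goals simp [h0, h1, h2]
  have h3 := key j 3
  rw [hadj j 3, h33] at h3
  refine mul_right_cancel₀ (mul_ne_zero hw3 hw3) ?_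
  linear_combination w 3 * key i j + w i * h3

theorem finrank_homogeneousSubmodule (K : Type*) [Field K] (m n : ℕ) :
    Module.finrank K (homogeneousSubmodule (Fin m) K n) = (m + n - 1).choose n := by
  have hset : {d : Fin m →₀ ℕ | d.degree = n} =
      ((Finset.univ : Finset (Fin m)).finsuppAntidiag n : Set (Fin m →₀ ℕ)) := by
    ext d
    simp [Finset.mem_finsuppAntidiag, Finsupp.degree_eq_sum]
  rw [homogeneousSubmodule_eq_finsupp_supported, hset,
    (AddMonoidAlgebra.supportedEquivFinsupp _).finrank_eq, Module.finrank_finsupp_self]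
  simp [Finset.card_finsuppAntidiag_nat_eq_choose]

/-- The forms `w₀, …, w₃`, which parametrize a cubic surface, satisfy no quadratic relation. -/
theorem quadric_eq_zero {K : Type*} [Field K] [CharZero K]
    (c₀₀ c₀₁ c₀₂ c₀₃ c₁₁ c₁₂ c₁₃ c₂₂ c₂₃ c₃₃ : K)
    (h : ∀ a b c w₀ w₁ w₂ w₃ : K, w₀ = b * c * (a + b + c) → w₁ = a * c * (a + b + c) →
      w₂ = a * b * (a + b + c) → w₃ = -(a * b * c) →
      c₀₀ * w₀ ^ 2 + c₁₁ * w₁ ^ 2 + c₂₂ * w₂ ^ 2 + c₃₃ * w₃ ^ 2 + c₀₁ * (w₀ * w₁) +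
        c₀₂ * (w₀ * w₂) + c₀₃ * (w₀ * w₃) + c₁₂ * (w₁ * w₂) + c₁₃ * (w₁ * w₃) +
        c₂₃ * (w₂ * w₃) = 0) :
    (c₀₀ = 0 ∧ c₁₁ = 0 ∧ c₂₂ = 0 ∧ c₃₃ = 0) ∧
      c₀₁ = 0 ∧ c₀₂ = 0 ∧ c₀₃ = 0 ∧ c₁₂ = 0 ∧ c₁₃ = 0 ∧ c₂₃ = 0 := by
  replace h (a b c : K) := h a b c _ _ _ _ rfl rfl rfl rfl
  have hd : c₀₀ = 0 ∧ c₁₁ = 0 ∧ c₂₂ = 0 ∧ c₃₃ = 0 := by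
    have h₀ := h 0 1 1
    have h₁ := h 1 0 1
    have h₂ := h 1 1 0
    have h₃ := h 1 1 (-2)
    norm_num at h₀ h₁ h₂ h₃
    exact ⟨h₀, h₁, h₂, h₃⟩
  refine ⟨hd, ?_⟩
  obtain ⟨rfl, rfl, rfl, rfl⟩ := hd
  have h₁ := h 1 1 1
  have h₂ := h 1 1 (-1)
  have h₃ := h 1 (-1) 1
  have h₄ := h (-1) 1 1
  have h₅ := h 2 1 1
  have h₆ := h 1 2 1
  norm_num at h₁ h₂ h₃ h₄ h₅ h₆
  clear h
  grind

/-- Eighteen of the products of two of the forms `w₀, …, w₃` with a variable are linearly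
independent. -/
theorem quadric_mul_linear_eq_zero {K : Type*} [Field K] [CharZero K]
    (p₀ q₀ r₀ p₁ q₁ r₁ p₂ q₂ r₂ p₃ q₃ r₃ c₀₁ c₀₂ c₁₂ c₀₃ c₁₃ c₂₃ : K)
    (h : ∀ a b c w₀ w₁ w₂ w₃ : K, w₀ = b * c * (a + b + c) → w₁ = a * c * (a + b + c) →
      w₂ = a * b * (a + b + c) → w₃ = -(a * b * c) →
      w₀ ^ 2 * (p₀ * a + q₀ * b + r₀ * c) + w₁ ^ 2 * (p₁ * a + q₁ * b + r₁ * c) +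
        w₂ ^ 2 * (p₂ * a + q₂ * b + r₂ * c) + w₃ ^ 2 * (p₃ * a + q₃ * b + r₃ * c) +
        c₀₁ * (w₀ * w₁ * c) + c₀₂ * (w₀ * w₂ * b) + c₁₂ * (w₁ * w₂ * a) +
        c₀₃ * (w₀ * w₃ * b) + c₁₃ * (w₁ * w₃ * a) + c₂₃ * (w₂ * w₃ * a) = 0) :
    (p₀ = 0 ∧ q₀ = 0 ∧ r₀ = 0) ∧ (p₁ = 0 ∧ q₁ = 0 ∧ r₁ = 0) ∧ (p₂ = 0 ∧ q₂ = 0 ∧ r₂ = 0) ∧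
      (p₃ = 0 ∧ q₃ = 0 ∧ r₃ = 0) ∧
      c₀₁ = 0 ∧ c₀₂ = 0 ∧ c₁₂ = 0 ∧ c₀₃ = 0 ∧ c₁₃ = 0 ∧ c₂₃ = 0 := by
  replace h (a b c : K) := h a b c _ _ _ _ rfl rfl rfl rfl
  have hsq : (q₀ = 0 ∧ r₀ = 0) ∧ (p₁ = 0 ∧ r₁ = 0) ∧ (p₂ = 0 ∧ q₂ = 0) ∧
      (q₃ = p₃ ∧ r₃ = p₃) := by
    have h₁ := h 0 1 1
    have h₂ := h 0 1 2
    have h₃ := h 1 0 1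
    have h₄ := h 1 0 2
    have h₅ := h 1 1 0
    have h₆ := h 1 2 0
    have h₇ := h 1 1 (-2)
    have h₈ := h 1 (-2) 1
    norm_num at h₁ h₂ h₃ h₄ h₅ h₆ h₇ h₈
    clear h
    grind
  obtain ⟨⟨rfl, rfl⟩, ⟨rfl, rfl⟩, ⟨rfl, rfl⟩, rfl, rfl⟩ := hsq
  have h₁ := h 1 1 1
  have h₂ := h 1 1 (-1)
  have h₃ := h 1 (-1) 1
  have h₄ := h (-1) 1 1
  have h₅ := h 2 1 1
  have h₆ := h 2 1 (-1)
  have h₇ := h 2 (-1) 1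
  have h₈ := h 1 2 1
  have h₉ := h 1 2 (-1)
  have h₁₀ := h 1 1 2
  norm_num at h₁ h₂ h₃ h₄ h₅ h₆ h₇ h₈ h₉ h₁₀
  clear h
  grind

theorem sum_mul_pderiv_pderiv {R : Type*} [CommRing R] {n : ℕ}
    (u : Fin n → MvPolynomial (Fin n) R) (a b c : Fin n) :
    ∑ i, ∑ j, u i * u j * pderiv i (pderiv j (X a * X b * X c)) =
      2 * (u a * u b * X c + u a * u c * X b + u b * u c * X a) := by
  simp [pderiv_X, Pi.single_apply, mul_add, Finset.sum_add_distrib]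
  simp [apply_ite]
  simp [Pi.single_apply, mul_add, Finset.sum_add_distrib]
  ring

/-- The variables of the cubic monomials on which the differential of the Hessian determinant
is injective. -/
def cubicIndex : Fin 38 → Fin 7 × Fin 7 × Fin 7 :=
  ![(0, 0, 4), (0, 0, 5), (0, 0, 6), (1, 1, 4), (1, 1, 5), (1, 1, 6), (2, 2, 4), (2, 2, 5),
    (2, 2, 6), (3, 3, 4), (3, 3, 5), (3, 3, 6), (0, 1, 6), (0, 2, 5), (1, 2, 4), (0, 3, 5),
    (1, 3, 4), (2, 3, 4), (0, 0, 0), (0, 0, 1), (0, 0, 2), (0, 0, 3), (0, 1, 1), (0, 1, 2),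
    (0, 1, 3), (0, 2, 2), (0, 2, 3), (0, 3, 3), (1, 1, 1), (1, 1, 2), (1, 1, 3), (1, 2, 2),
    (1, 2, 3), (1, 3, 3), (2, 2, 2), (2, 2, 3), (2, 3, 3), (3, 3, 3)]

theorem cubicIndex_coeff_eq_zero {K : Type*} [Field K] [CharZero K] (g : Fin 38 → K)
    (h : ∀ p w : Fin 7 → K, w = ![p 5 * p 6 * (p 4 + p 5 + p 6), p 4 * p 6 * (p 4 + p 5 + p 6),
        p 4 * p 5 * (p 4 + p 5 + p 6), -(p 4 * p 5 * p 6), 0, 0, 0] →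
      ∑ k, g k * (w (cubicIndex k).1 * w (cubicIndex k).2.1 * p (cubicIndex k).2.2 +
        w (cubicIndex k).1 * w (cubicIndex k).2.2 * p (cubicIndex k).2.1 +
        w (cubicIndex k).2.1 * w (cubicIndex k).2.2 * p (cubicIndex k).1) = 0) : g = 0 := by
  replace h (x₀ x₁ x₂ x₃ a b c w₀ w₁ w₂ w₃ : K) (h₀ : w₀ = b * c * (a + b + c))
      (h₁ : w₁ = a * c * (a + b + c)) (h₂ : w₂ = a * b * (a + b + c)) (h₃ : w₃ = -(a * b * c)) :=
    h ![x₀, x₁, x₂, x₃, a, b, c] ![w₀, w₁, w₂, w₃, 0, 0, 0] (by subst h₀ h₁ h₂ h₃; rfl)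
  simp [Fin.sum_univ_succ, cubicIndex] at h
  have hlin := quadric_mul_linear_eq_zero (g 0) (g 1) (g 2) (g 3) (g 4) (g 5) (g 6) (g 7) (g 8)
    (g 9) (g 10) (g 11) (g 12) (g 13) (g 14) (g 15) (g 16) (g 17) (by
      intro a b c w₀ w₁ w₂ w₃ h₀ h₁ h₂ h₃
      linear_combination h 0 0 0 0 a b c w₀ w₁ w₂ w₃ h₀ h₁ h₂ h₃)
  have hquad₀ := quadric_eq_zero (3 * g 18) (2 * g 19) (2 * g 20)
    (2 * g 21) (g 22) (g 23) (g 24) (g 25) (g 26) (g 27) (by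
      intro a b c w₀ w₁ w₂ w₃ h₀ h₁ h₂ h₃
      linear_combination h 1 0 0 0 a b c w₀ w₁ w₂ w₃ h₀ h₁ h₂ h₃ -
        h 0 0 0 0 a b c w₀ w₁ w₂ w₃ h₀ h₁ h₂ h₃)
  have hquad₁ := quadric_eq_zero (g 19) (2 * g 22) (g 23) (g 24)
    (3 * g 28) (2 * g 29) (2 * g 30) (g 31) (g 32) (g 33) (by
      intro a b c w₀ w₁ w₂ w₃ h₀ h₁ h₂ h₃
      linear_combination h 0 1 0 0 a b c w₀ w₁ w₂ w₃ h₀ h₁ h₂ h₃ -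
        h 0 0 0 0 a b c w₀ w₁ w₂ w₃ h₀ h₁ h₂ h₃)
  have hquad₂ := quadric_eq_zero (g 20) (g 23) (2 * g 25) (g 26) (g 29)
    (2 * g 31) (g 32) (3 * g 34) (2 * g 35) (g 36) (by
      intro a b c w₀ w₁ w₂ w₃ h₀ h₁ h₂ h₃
      linear_combination h 0 0 1 0 a b c w₀ w₁ w₂ w₃ h₀ h₁ h₂ h₃ -
        h 0 0 0 0 a b c w₀ w₁ w₂ w₃ h₀ h₁ h₂ h₃)
  have hquad₃ := quadric_eq_zero (g 21) (g 24) (g 26) (2 * g 27) (g 30)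
    (g 32) (2 * g 33) (g 35) (2 * g 36) (3 * g 37) (by
      intro a b c w₀ w₁ w₂ w₃ h₀ h₁ h₂ h₃
      linear_combination h 0 0 0 1 a b c w₀ w₁ w₂ w₃ h₀ h₁ h₂ h₃ -
        h 0 0 0 0 a b c w₀ w₁ w₂ w₃ h₀ h₁ h₂ h₃)
  clear h
  ext k
  fin_cases k <;> simp_all

/-- A vector spanning the kernel of the Hessian of the cubic
`½(x₀x₄² + x₁x₅² + x₂x₆² + x₃(x₄+x₅+x₆)²)`. -/
noncomputable def hessianKernel (K : Type*) [Field K] : Fin 7 → MvPolynomial (Fin 7) K :=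
  ![X 5 * X 6 * (X 4 + X 5 + X 6), X 4 * X 6 * (X 4 + X 5 + X 6), X 4 * X 5 * (X 4 + X 5 + X 6),
    -(X 4 * X 5 * X 6), 0, 0, 0]

theorem hessian_eq {K : Type*} [Field K] [CharZero K] :
    (Matrix.of fun a b : Fin 7 => pderiv a (pderiv b (C (1 / 2 : K) *
      (X 0 * X 4 ^ 2 + X 1 * X 5 ^ 2 + X 2 * X 6 ^ 2 + X 3 * (X 4 + X 5 + X 6) ^ 2)))) =
    !![0, 0, 0, 0, X 4, 0, 0;
        0, 0, 0, 0, 0, X 5, 0;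
        0, 0, 0, 0, 0, 0, X 6;
        0, 0, 0, 0, X 4 + X 5 + X 6, X 4 + X 5 + X 6, X 4 + X 5 + X 6;
        X 4, 0, 0, X 4 + X 5 + X 6, X 0 + X 3, X 3, X 3;
        0, X 5, 0, X 4 + X 5 + X 6, X 3, X 1 + X 3, X 3;
        0, 0, X 6, X 4 + X 5 + X 6, X 3, X 3, X 2 + X 3] := by
  have hC : (C (1 / 2 : K) : MvPolynomial (Fin 7) K) * 2 = 1 := by
    rw [← map_ofNat C 2, ← C_mul]
    norm_num
  have hD (i : Fin 7) : pderiv i (2 : MvPolynomial (Fin 7) K) = 0 := by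
    rw [← map_ofNat C 2, pderiv_C]
  ext1 i j
  rw [Matrix.of_apply, pderiv_C_mul, pderiv_C_mul]
  refine Eq.trans (congrArg _ ?_) ((mul_assoc _ 2 _).symm.trans
    ((congrArg (· * _) hC).trans (one_mul _)))
  fin_cases i <;> fin_cases j <;> simp [pderiv_X, hD] <;> ring

theorem hessian_adjugate_apply {K : Type*} [Field K] [CharZero K] (i j : Fin 7) :
    (Matrix.of fun a b : Fin 7 => pderiv a (pderiv b (C (1 / 2 : K) *
      (X 0 * X 4 ^ 2 + X 1 * X 5 ^ 2 + X 2 * X 6 ^ 2 +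
        X 3 * (X 4 + X 5 + X 6) ^ 2)))).adjugate i j =
      -(hessianKernel K i * hessianKernel K j) := by
  rw [hessian_eq, hessianKernel]
  exact hessian_adjugate _ _ _ _ _ _ _ _ (X_ne_zero _) (X_ne_zero _) (X_ne_zero _) i j

/-- For the cubic `f = ½(x₀x₄² + x₁x₅² + x₂x₆² + x₃L²)` in `K[x₀,…,x₆]` with
`L = x₄+x₅+x₆`, the differential at `f` of the map `F : S₃ → S₇`, `v ↦ det(Hess_v)`,
namely `d_fF(v) = Σ_{i,j} δ_{ij} ∂²v/∂x_i∂x_j` with `δ_{ij}` the cofactors of `Hess_f`,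
has rank at least `38` on the 84-dimensional space of cubics; consequently the kernel of
`d_fF` on cubics has dimension at most `46`, so the tangent space to the scheme
`{hess = 0} ⊂ ℙ(S₃) = ℙ^{83}` at `f` has dimension at most `45`. -/
theorem smooth_point_of_maximal_family_rank_ge
    {K : Type*} [Field K] [CharZero K]
    (f : MvPolynomial (Fin 7) K)
    (hf : f = C (1 / 2 : K) *
      (X 0 * X 4 ^ 2 + X 1 * X 5 ^ 2 + X 2 * X 6 ^ 2 + X 3 * (X 4 + X 5 + X 6) ^ 2))
    (D : MvPolynomial (Fin 7) K →ₗ[K] MvPolynomial (Fin 7) K)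
    (hD : D = ∑ i : Fin 7, ∑ j : Fin 7,
        LinearMap.mulLeft K
            ((Matrix.of fun a b : Fin 7 => pderiv a (pderiv b f)).adjugate j i) ∘ₗ
          ((pderiv i).toLinearMap ∘ₗ (pderiv j).toLinearMap)) :
    38 ≤ Module.finrank K ↥(Submodule.map D (homogeneousSubmodule (Fin 7) K 3)) ∧
      Module.finrank K ↥(homogeneousSubmodule (Fin 7) K 3 ⊓ LinearMap.ker D) ≤ 46 := by
  subst hf
  set S := homogeneousSubmodule (Fin 7) K 3
  have : Module.Finite K S := Module.Finite.iff_fg.mpr (homogeneousSubmodule_fg _ _ 3)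
  have hDX (a b c : Fin 7) : D (X a * X b * X c) =
      -(2 * (hessianKernel K a * hessianKernel K b * X c +
        hessianKernel K a * hessianKernel K c * X b +
        hessianKernel K b * hessianKernel K c * X a)) := by
    rw [← sum_mul_pderiv_pderiv, hD]
    simp only [hessian_adjugate_apply, LinearMap.sum_apply, LinearMap.comp_apply,
      LinearMap.mulLeft_apply, Derivation.coeFn_coe, neg_mul, Finset.sum_neg_distrib]
    simp only [mul_comm]
  let v (k : Fin 38) : MvPolynomial (Fin 7) K :=
    X (cubicIndex k).1 * X (cubicIndex k).2.1 * X (cubicIndex k).2.2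
  have hvS (k : Fin 38) : v k ∈ S :=
    ((isHomogeneous_X K _).mul (isHomogeneous_X K _)).mul (isHomogeneous_X K _)
  have hli : LinearIndependent K fun k => (⟨D (v k), v k, hvS k, rfl⟩ : S.map D) := by
    rw [Fintype.linearIndependent_iff]
    intro g hg
    replace hg : ∑ k, g k • D (v k) = 0 := by simpa using congrArg Subtype.val hg
    refine congrFun (cubicIndex_coeff_eq_zero g fun p w hw => ?_)
    have hker (i : Fin 7) : eval p (hessianKernel K i) = w i := by
      subst hw
      fin_cases i <;> simp [hessianKernel]
    have h := congrArg (eval p) hg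
    simp only [v, hDX, map_sum, smul_eval, map_neg, map_mul, map_add, eval_X, hker, map_zero,
      map_ofNat] at h
    refine (mul_eq_zero (a := (-2 : K)).mp ?_).resolve_left (by norm_num)
    rw [← h, Finset.mul_sum]
    exact Finset.sum_congr rfl fun k _ => by ring
  have hrank : 38 ≤ Module.finrank K (S.map D) := by
    simpa using hli.fintype_card_le_finrank
  refine ⟨hrank, ?_⟩
  have hS : Module.finrank K S = 84 := finrank_homogeneousSubmodule K 7 3
  have hadd := (D.domRestrict S).finrank_range_add_finrank_ker
  rw [LinearMap.range_domRestrict, LinearMap.ker_domRestrict] at hadd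
  have hinf : Module.finrank K (S ⊓ LinearMap.ker D : Submodule K _) =
      Module.finrank K ((LinearMap.ker D).comap S.subtype) := by
    rw [← Submodule.map_comap_subtype]
    exact Submodule.finrank_map_subtype_eq _ _
  omega
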